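/- arXiv:1010.1077 — 2 statements merged into one kernel-verified Lean document; each statement's English description precedes it below -/
import Mathlib

section
/- Let P ∈ 𝓜³ be a maximal lattice-free integral polytope that is a pyramid P = conv(F ∪ {a}) whose base F is a quadrilateral contained in the plane ℝ² × {0} and whose apex a = (a₁, a₂, a₃) satisfies a₃ = 3. Then there exist a matrix U ∈ ℤ^{3×3} with |det U| = 1 and a vector v ∈ ℤ³ such that P = U·M₉ + v, where M₉ = conv{(−1,0,0), (0,−1,0), (2,0,0), (0,2,0), (1,1,3)}. -/
open Set

/-- The set of integer points `ℤ^d` inside `ℝ^d`. -/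
def intPts (d : ℕ) : Set (Fin d → ℝ) := {x | ∀ i, ∃ z : ℤ, x i = (z : ℝ)}

/-- The lattice `Λ = s·ℤ^d` inside `ℝ^d`. -/
def sLat (d s : ℕ) : Set (Fin d → ℝ) := {x | ∀ i, ∃ z : ℤ, x i = (s : ℝ) * (z : ℝ)}

/-- A polyhedron: a finite intersection of closed halfspaces. -/
def IsPolyhedron {d : ℕ} (P : Set (Fin d → ℝ)) : Prop :=
  ∃ (n : ℕ) (A : Fin n → Fin d → ℝ) (b : Fin n → ℝ),
    P = {x | ∀ i, (∑ j, A i j * x j) ≤ b i}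

/-- An integral set: it equals the convex hull of its integer points. -/
def IsIntegralPoly {d : ℕ} (P : Set (Fin d → ℝ)) : Prop :=
  P = convexHull ℝ (P ∩ intPts d)

/-- The affine map `x ↦ U·x + t` with integer matrix `U` and translation `t : ℝ^d`. -/
noncomputable def affMap {d : ℕ} (U : Matrix (Fin d) (Fin d) ℤ) (t : Fin d → ℝ)
    (x : Fin d → ℝ) : Fin d → ℝ := fun i => (∑ j, (U i j : ℝ) * x j) + t i

/-- Membership in `𝓜³`: a maximal lattice-free integral polytope in `ℝ³`, i.e. a bounded
integral polyhedron with nonempty interior, whose interior contains no integer point, and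
which is not properly contained in any convex set whose interior contains no integer point. -/
def MemM3 (P : Set (Fin 3 → ℝ)) : Prop :=
  IsPolyhedron P ∧ Bornology.IsBounded P ∧ IsIntegralPoly P ∧ (interior P).Nonempty ∧
    interior P ∩ intPts 3 = ∅ ∧
    ∀ K : Set (Fin 3 → ℝ), Convex ℝ K → interior K ∩ intPts 3 = ∅ → P ⊆ K → P = K

def M9 : Set (Fin 3 → ℝ) :=
  convexHull ℝ ({![-1,0,0], ![0,-1,0], ![2,0,0], ![0,2,0], ![1,1,3]} : Set (Fin 3 → ℝ))

/-- Twice the signed area of the projection of the triangle `p q r` to the first two coordinates. -/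
def planeOrient (p q r : Fin 3 → ℝ) : ℝ :=
  (q 0 - p 0) * (r 1 - p 1) - (q 1 - p 1) * (r 0 - p 0)

/-- Every partition of `Fin 4` has a part with at most one element or splits `Fin 4` in pairs. -/
lemma Finset.fin_four_partition (I : Finset (Fin 4)) :
    I = ∅ ∨ Iᶜ = ∅ ∨ (∃ i, I = {i}) ∨ (∃ i, Iᶜ = {i}) ∨
      ∃ σ : Fin 4 → Fin 4, Function.Bijective σ ∧ I = {σ 0, σ 2} ∧ Iᶜ = {σ 1, σ 3} := by
  have h : ∀ a b c d : Fin 4, a ≠ b → a ≠ c → a ≠ d → b ≠ c → b ≠ d → c ≠ d →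
      Function.Injective ![a, b, c, d] := by
    unfold Function.Injective; decide
  have key : I = ∅ ∨ Iᶜ = ∅ ∨ (∃ i, I = {i}) ∨ (∃ i, Iᶜ = {i}) ∨
      ∃ a b c d : Fin 4, (a ≠ b ∧ a ≠ c ∧ a ≠ d ∧ b ≠ c ∧ b ≠ d ∧ c ≠ d) ∧
        I = {a, c} ∧ Iᶜ = {b, d} := by
    revert I; decide
  rcases key with h1 | h1 | h1 | h1 | ⟨a, b, c, d, ⟨h1, h2, h3, h4, h5, h6⟩, h7, h8⟩
  · exact Or.inl h1
  · exact Or.inr (Or.inl h1)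
  · exact Or.inr (Or.inr (Or.inl h1))
  · exact Or.inr (Or.inr (Or.inr (Or.inl h1)))
  · exact Or.inr (Or.inr (Or.inr (Or.inr ⟨![a, b, c, d],
      Finite.injective_iff_bijective.1 (h a b c d h1 h2 h3 h4 h5 h6), h7, h8⟩)))

/-- Four convexly independent points in a plane can be labelled so that the diagonals cross. -/
lemma ConvexIndependent.exists_crossing {f : Fin 4 → Fin 3 → ℝ} (hf : ConvexIndependent ℝ f)
    (hz : ∀ i, f i 2 = 0) :
    ∃ σ : Fin 4 → Fin 4, Function.Bijective σ ∧
      (segment ℝ (f (σ 0)) (f (σ 2)) ∩ segment ℝ (f (σ 1)) (f (σ 3))).Nonempty := by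
  have hdep : ¬ AffineIndependent ℝ f := by
    intro h
    have h1 : Module.finrank ℝ (vectorSpan ℝ (Set.range f)) = 3 :=
      h.finrank_vectorSpan (by simp)
    have h2 : vectorSpan ℝ (Set.range f) ≤ LinearMap.ker (LinearMap.proj (R := ℝ)
        (φ := fun _ : Fin 3 => ℝ) 2) := by
      rw [vectorSpan_def, Submodule.span_le]
      rintro _ ⟨_, ⟨i, rfl⟩, _, ⟨j, rfl⟩, rfl⟩
      simp [hz]
    have h3 := Submodule.finrank_mono h2
    have h4 := LinearMap.finrank_range_add_finrank_ker (LinearMap.proj (R := ℝ)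
        (φ := fun _ : Fin 3 => ℝ) 2)
    have h5 : LinearMap.range (LinearMap.proj (R := ℝ) (φ := fun _ : Fin 3 => ℝ) 2) = ⊤ :=
      LinearMap.range_eq_top.2 (LinearMap.proj_surjective 2)
    rw [h5] at h4
    simp at h4
    lia
  obtain ⟨I, x, hx1, hx2⟩ := Convex.radon_partition hdep
  classical
  have hI : I = ((I.toFinset : Finset (Fin 4)) : Set (Fin 4)) := by simp
  have hIc : Iᶜ = ((I.toFinsetᶜ : Finset (Fin 4)) : Set (Fin 4)) := by simp
  rw [hI] at hx1
  rw [hIc] at hx2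
  generalize I.toFinset = J at hx1 hx2
  rcases Finset.fin_four_partition J with h | h | ⟨i, h⟩ | ⟨i, h⟩ | ⟨σ, hσ, h, h'⟩
  · simp [h] at hx1
  · simp [h] at hx2
  · have hx := hx1
    rw [h] at hx
    simp only [Finset.coe_singleton, Set.image_singleton, convexHull_singleton,
      Set.mem_singleton_iff] at hx
    subst hx
    have := hf _ _ hx2
    simp [h] at this
  · have hx := hx2
    rw [h] at hx
    simp only [Finset.coe_singleton, Set.image_singleton, convexHull_singleton,
      Set.mem_singleton_iff] at hx
    subst hx
    have := hf _ _ hx1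
    have h2 : i ∈ Jᶜ := by simp [h]
    rw [Finset.mem_compl] at h2
    exact absurd this (by simpa using h2)
  · refine ⟨σ, hσ, x, ?_, ?_⟩
    · rw [h] at hx1
      simpa [Set.image_pair, convexHull_pair] using hx1
    · rw [h'] at hx2
      simpa [Set.image_pair, convexHull_pair] using hx2

lemma ConvexIndependent.notMem_segment {f : Fin 4 → Fin 3 → ℝ} (hf : ConvexIndependent ℝ f)
    {i j k : Fin 4} (hij : i ≠ j) (hik : i ≠ k) : f i ∉ segment ℝ (f j) (f k) := by
  intro h
  rw [← convexHull_pair, ← Set.image_pair] at h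
  have := hf _ _ h
  simp [hij, hik] at this

/-- No three of four convexly independent points in a horizontal plane are collinear. -/
lemma ConvexIndependent.planeOrient_ne_zero {f : Fin 4 → Fin 3 → ℝ} (hf : ConvexIndependent ℝ f)
    (hz : ∀ i, f i 2 = 0) {i j k : Fin 4} (hij : i ≠ j) (hik : i ≠ k) (hjk : j ≠ k) :
    planeOrient (f i) (f j) (f k) ≠ 0 := by
  intro h
  unfold planeOrient at h
  obtain ⟨r, hr⟩ : ∃ r : ℝ, f j = f i + r • (f k - f i) := by
    have hne : f i ≠ f k := fun h => hik (hf.injective h)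
    by_cases h0 : f k 0 = f i 0
    · have h1 : f k 1 - f i 1 ≠ 0 := by
        intro h1
        apply hne
        ext l
        fin_cases l
        · exact h0.symm
        · simpa using (sub_eq_zero.1 h1).symm
        · simp [hz]
      refine ⟨(f j 1 - f i 1) / (f k 1 - f i 1), ?_⟩
      have h2 : f j 0 = f i 0 := by
        have : (f j 0 - f i 0) * (f k 1 - f i 1) = 0 := by rw [h0] at h; linarith
        have := (mul_eq_zero.1 this).resolve_right h1
        linarith
      ext l
      fin_cases l
      · simp [h0, h2]
      · simp [div_mul_cancel₀ _ h1]
      · simp [hz]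
    · have h1 : f k 0 - f i 0 ≠ 0 := sub_ne_zero.2 h0
      refine ⟨(f j 0 - f i 0) / (f k 0 - f i 0), ?_⟩
      ext l
      fin_cases l
      · simp [div_mul_cancel₀ _ h1]
      · simp
        field_simp
        linarith
      · simp [hz]
  rcases lt_or_ge r 0 with h1 | h1
  · refine hf.notMem_segment hij hik ⟨1 / (1 - r), -r / (1 - r), by
      apply div_nonneg <;> linarith, by apply div_nonneg <;> linarith, by
      field_simp [show 1 - r ≠ 0 by linarith]; ring, ?_⟩
    have : 1 - r ≠ 0 := by linarith
    rw [hr]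
    ext l
    simp
    field_simp
    ring
  rcases le_or_gt r 1 with h2 | h2
  · refine hf.notMem_segment hij.symm hjk ⟨1 - r, r, by linarith, h1, by ring, ?_⟩
    rw [hr]
    ext l
    simp
    ring
  · refine hf.notMem_segment hik.symm hjk.symm ⟨1 - 1 / r, 1 / r, ?_, by positivity, by ring, ?_⟩
    · rw [sub_nonneg, div_le_one] <;> linarith
    · rw [hr]
      ext l
      simp
      field_simp
      ring

/-- Crossing diagonals force a consistent orientation. -/
lemma planeOrient_ratio_of_crossing {A B C D x : Fin 3 → ℝ} (hA : A ∉ segment ℝ B D)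
    (hB : B ∉ segment ℝ A C) (hC : C ∉ segment ℝ B D) (hD : D ∉ segment ℝ A C)
    (hx : x ∈ segment ℝ A C) (hx' : x ∈ segment ℝ B D) :
    ∃ κ₁ κ₂ κ₃ : ℝ, 0 < κ₁ ∧ 0 < κ₂ ∧ 0 < κ₃ ∧ planeOrient B C D = κ₁ * planeOrient A B C ∧
      planeOrient C D A = κ₂ * planeOrient A B C ∧
      planeOrient D A B = κ₃ * planeOrient A B C := by
  obtain ⟨s, s', hs, hs', hss, hsx⟩ := hx
  obtain ⟨t, t', ht, ht', htt, htx⟩ := hx'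
  have ps : 0 < s := by
    refine hs.lt_of_ne' fun h0 => hC ⟨t, t', ht, ht', htt, ?_⟩
    rw [htx, ← hsx, h0, show s' = 1 by linarith]; simp
  have ps' : 0 < s' := by
    refine hs'.lt_of_ne' fun h0 => hA ⟨t, t', ht, ht', htt, ?_⟩
    rw [htx, ← hsx, h0, show s = 1 by linarith]; simp
  have pt : 0 < t := by
    refine ht.lt_of_ne' fun h0 => hD ⟨s, s', hs, hs', hss, ?_⟩
    rw [hsx, ← htx, h0, show t' = 1 by linarith]; simp
  have pt' : 0 < t' := by
    refine ht'.lt_of_ne' fun h0 => hB ⟨s, s', hs, hs', hss, ?_⟩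
    rw [hsx, ← htx, h0, show t = 1 by linarith]; simp
  have e0 : s * A 0 + s' * C 0 = t * B 0 + t' * D 0 := by
    simpa using congrFun (hsx.trans htx.symm) 0
  have e1 : s * A 1 + s' * C 1 = t * B 1 + t' * D 1 := by
    simpa using congrFun (hsx.trans htx.symm) 1
  obtain rfl : s' = 1 - s := by linarith
  obtain rfl : t' = 1 - t := by linarith
  have k1 : (1 - t) * planeOrient B C D = s * planeOrient A B C := by
    unfold planeOrient
    linear_combination (C 1 - B 1) * e0 + (B 0 - C 0) * e1
  have k2 : (1 - t) * planeOrient C D A = t * planeOrient A B C := by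
    unfold planeOrient
    linear_combination (C 1 - A 1) * e0 + (A 0 - C 0) * e1
  have k3 : (1 - t) * planeOrient D A B = (1 - s) * planeOrient A B C := by
    unfold planeOrient
    linear_combination (B 1 - A 1) * e0 + (A 0 - B 0) * e1
  refine ⟨s / (1 - t), t / (1 - t), (1 - s) / (1 - t), by positivity, by positivity,
    by positivity, ?_, ?_, ?_⟩
  · field_simp; linarith
  · field_simp; linarith
  · field_simp; linarith

/-- A quadrilateral in a horizontal plane has a counterclockwise labelling of its vertices. -/
lemma exists_cyclic_labelling {F : Set (Fin 3 → ℝ)}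
    (hFpoly : ∃ V : Finset (Fin 3 → ℝ), F = convexHull ℝ (V : Set (Fin 3 → ℝ)))
    (hFquad : (Set.extremePoints ℝ F).ncard = 4)
    (hFplane : F ⊆ {x : Fin 3 → ℝ | x 2 = 0}) :
    ∃ w : Fin 4 → Fin 3 → ℝ, (∀ i, w i ∈ Set.extremePoints ℝ F) ∧
      F = convexHull ℝ (Set.range w) ∧
      ∀ i, 0 < planeOrient (w i) (w (i + 1)) (w (i + 2)) := by
  obtain ⟨V, hV⟩ := hFpoly
  have hconv : Convex ℝ F := hV ▸ convex_convexHull ℝ _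
  have hcomp : IsCompact F := hV ▸ V.finite_toSet.isCompact_convexHull ℝ
  have hfin : (Set.extremePoints ℝ F).Finite := Set.finite_of_ncard_ne_zero (by lia)
  have hFE : F = convexHull ℝ (Set.extremePoints ℝ F) := by
    rw [← (hfin.isClosed_convexHull ℝ).closure_eq]
    exact (closure_convexHull_extremePoints hcomp hconv).symm
  have : Finite (Set.extremePoints ℝ F) := hfin
  have e : Fin 4 ≃ Set.extremePoints ℝ F :=
    (Finite.equivFinOfCardEq (α := Set.extremePoints ℝ F) hFquad).symm
  obtain ⟨f, hf⟩ : ∃ f : Fin 4 → Fin 3 → ℝ, f = fun i => (e i : Fin 3 → ℝ) := ⟨_, rfl⟩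
  have hrange : Set.range f = Set.extremePoints ℝ F := by
    rw [hf]
    exact (e.surjective.range_comp Subtype.val).trans Subtype.range_coe
  have hind : ConvexIndependent ℝ f := by
    rw [hf]
    exact hconv.convexIndependent_extremePoints.comp_embedding e.toEmbedding
  have hmem : ∀ i, f i ∈ Set.extremePoints ℝ F := fun i => hrange ▸ Set.mem_range_self i
  have hz : ∀ i, f i 2 = 0 := fun i => hFplane (hmem i).1
  obtain ⟨σ, hσ, x, hx, hx'⟩ := hind.exists_crossing hz
  have hne : ∀ {i j : Fin 4}, i ≠ j → σ i ≠ σ j := fun h => hσ.1.ne h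
  have n01 := hne (show (0 : Fin 4) ≠ 1 by decide)
  have n02 := hne (show (0 : Fin 4) ≠ 2 by decide)
  have n03 := hne (show (0 : Fin 4) ≠ 3 by decide)
  have n12 := hne (show (1 : Fin 4) ≠ 2 by decide)
  have n13 := hne (show (1 : Fin 4) ≠ 3 by decide)
  have n23 := hne (show (2 : Fin 4) ≠ 3 by decide)
  have hA := hind.notMem_segment n01 n03
  have hB := hind.notMem_segment n01.symm n12
  have hC := hind.notMem_segment n12.symm n23
  have hD := hind.notMem_segment n03.symm n23.symm
  have hFf : F = convexHull ℝ (Set.range fun i => f (σ i)) := by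
    rw [hFE, ← hrange]
    exact congrArg _ (hσ.2.range_comp f).symm
  obtain ⟨κ₁, κ₂, κ₃, h1, h2, h3, e1, e2, e3⟩ :=
    planeOrient_ratio_of_crossing hA hB hC hD hx hx'
  rcases (hind.planeOrient_ne_zero hz n01 n02 n12).lt_or_gt with h | h
  · refine ⟨fun i => f (σ (-i)), fun i => hmem _, ?_, ?_⟩
    · rw [hFf]
      exact congrArg _ ((Equiv.neg (Fin 4)).surjective.range_comp fun i => f (σ i)).symm
    · have hswap : ∀ p q r, planeOrient p q r = -planeOrient r q p := by
        intro p q r; unfold planeOrient; ring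
      intro i
      rw [hswap, neg_pos]
      fin_cases i
      · exact e2 ▸ mul_neg_of_pos_of_neg h2 h
      · exact e1 ▸ mul_neg_of_pos_of_neg h1 h
      · exact h
      · exact e3 ▸ mul_neg_of_pos_of_neg h3 h
  · refine ⟨fun i => f (σ i), fun i => hmem _, hFf, fun i => ?_⟩
    fin_cases i
    · exact h
    · exact e1 ▸ mul_pos h1 h
    · exact e2 ▸ mul_pos h2 h
    · exact e3 ▸ mul_pos h3 h

/-- The affine function of `x` whose zero plane passes through the points `p`, `q` of height `0`
and the point `a` of height `3`. -/
def pyramidSide (a p q x : Fin 3 → ℝ) : ℝ :=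
  (q 0 - p 0) * (3 * x 1 - x 2 * a 1 - (3 - x 2) * p 1) -
    (q 1 - p 1) * (3 * x 0 - x 2 * a 0 - (3 - x 2) * p 0)

lemma pyramidSide_combo (a p q x y : Fin 3 → ℝ) {s t : ℝ} (h : s + t = 1) :
    pyramidSide a p q (s • x + t • y) = s * pyramidSide a p q x + t * pyramidSide a p q y := by
  obtain rfl : s = 1 - t := by linarith
  simp only [pyramidSide, Pi.add_apply, Pi.smul_apply, smul_eq_mul]
  ring

lemma pyramidSide_add_smul (a p q x y z : Fin 3 → ℝ) (t : ℝ) :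
    pyramidSide a p q (x + t • (y - z)) =
      pyramidSide a p q x + t * (pyramidSide a p q y - pyramidSide a p q z) := by
  simp only [pyramidSide, Pi.add_apply, Pi.sub_apply, Pi.smul_apply, smul_eq_mul]
  ring

lemma convex_le_pyramidSide (a p q : Fin 3 → ℝ) (c : ℝ) :
    Convex ℝ {x | c ≤ pyramidSide a p q x} := by
  intro x hx y hy s t hs ht hst
  simp only [mem_ofPred_eq] at hx hy ⊢
  rw [pyramidSide_combo _ _ _ _ _ hst]
  obtain rfl : s = 1 - t := by linarith
  nlinarith [mul_le_mul_of_nonneg_left hx hs, mul_le_mul_of_nonneg_left hy ht]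

lemma pyramidSide_apex {a : Fin 3 → ℝ} (ha : a 2 = 3) (p q : Fin 3 → ℝ) :
    pyramidSide a p q a = 0 := by
  simp only [pyramidSide, ha]; ring

/-- An affine function bounded below on `K` and decreasing in some direction is strictly above the
bound in the interior of `K`. -/
lemma lt_of_mem_interior {K : Set (Fin 3 → ℝ)} {x : Fin 3 → ℝ} (hx : x ∈ interior K)
    {φ : (Fin 3 → ℝ) → ℝ} {c κ : ℝ} (d : Fin 3 → ℝ) (hφ : ∀ y ∈ K, c ≤ φ y)
    (hd : ∀ t : ℝ, φ (x + t • d) = φ x - t * κ) (hκ : 0 < κ) : c < φ x := by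
  have hcont : Filter.Tendsto (fun t : ℝ => x + t • d) (nhdsWithin 0 (Ioi 0)) (nhds x) := by
    have : Continuous fun t : ℝ => x + t • d := by fun_prop
    have := (this.tendsto 0).mono_left (nhdsWithin_le_nhds (s := Ioi 0))
    simpa using this
  have hev := hcont.eventually (mem_interior_iff_mem_nhds.1 hx)
  obtain ⟨t, ht, htpos⟩ := (hev.and self_mem_nhdsWithin).exists
  have h1 := hφ _ ht
  rw [hd] at h1
  have : 0 < t * κ := mul_pos htpos hκ
  linarith

section Pyramid

variable {w : Fin 4 → Fin 3 → ℝ} {a : Fin 3 → ℝ}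

lemma pyramidSide_vertex (hz : ∀ i, w i 2 = 0)
    (ho : ∀ i, 0 < planeOrient (w i) (w (i + 1)) (w (i + 2))) (i : Fin 4) :
    pyramidSide a (w i) (w (i + 1)) (w i) = 0 ∧ pyramidSide a (w i) (w (i + 1)) (w (i + 1)) = 0 ∧
      0 < pyramidSide a (w i) (w (i + 1)) (w (i + 2)) ∧
      0 < pyramidSide a (w i) (w (i + 1)) (w (i + 3)) := by
  have e1 : i + 3 + 1 = i := by revert i; decide
  have e2 : i + 3 + 2 = i + 1 := by revert i; decide
  have h2 := ho i
  have h3 := ho (i + 3)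
  rw [e1, e2] at h3
  simp only [planeOrient] at h2 h3
  refine ⟨?_, ?_, ?_, ?_⟩ <;> simp only [pyramidSide, hz]
  · ring
  · ring
  · linarith
  · linarith

lemma pyramidSide_vertex_nonneg (hz : ∀ i, w i 2 = 0)
    (ho : ∀ i, 0 < planeOrient (w i) (w (i + 1)) (w (i + 2))) (i j : Fin 4) :
    0 ≤ pyramidSide a (w i) (w (i + 1)) (w j) := by
  have : j = i ∨ j = i + 1 ∨ j = i + 2 ∨ j = i + 3 := by revert i j; decide
  obtain ⟨h0, h1, h2, h3⟩ := pyramidSide_vertex (a := a) hz ho i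
  rcases this with rfl | rfl | rfl | rfl
  exacts [h0.ge, h1.ge, h2.le, h3.le]

/-- Valid inequalities for a pyramid. -/
lemma pyramid_subset (hz : ∀ i, w i 2 = 0) (ha : a 2 = 3)
    (ho : ∀ i, 0 < planeOrient (w i) (w (i + 1)) (w (i + 2))) {x : Fin 3 → ℝ}
    (hx : x ∈ convexHull ℝ (insert a (Set.range w))) :
    0 ≤ x 2 ∧ x 2 ≤ 3 ∧ ∀ i, 0 ≤ pyramidSide a (w i) (w (i + 1)) x := by
  have h1 : Convex ℝ {x : Fin 3 → ℝ | 0 ≤ x 2} :=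
    convex_halfSpace_ge (LinearMap.isLinear (LinearMap.proj 2)) 0
  have h2 : Convex ℝ {x : Fin 3 → ℝ | x 2 ≤ 3} :=
    convex_halfSpace_le (LinearMap.isLinear (LinearMap.proj 2)) 3
  refine ⟨convexHull_min ?_ h1 hx, convexHull_min ?_ h2 hx, fun i =>
    convexHull_min ?_ (convex_le_pyramidSide a (w i) (w (i + 1)) 0) hx⟩
  · rintro y (rfl | ⟨j, rfl⟩)
    · simp [ha]
    · simp [hz]
  · rintro y (rfl | ⟨j, rfl⟩)
    · simp [ha]
    · simp [hz]
  · rintro y (rfl | ⟨j, rfl⟩)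
    · exact (pyramidSide_apex ha _ _).ge
    · exact pyramidSide_vertex_nonneg hz ho i j

lemma Convex.combo_four_mem {S : Set (Fin 3 → ℝ)} (hS : Convex ℝ S) {x p q r s : Fin 3 → ℝ}
    (hp : p ∈ S) (hq : q ∈ S) (hr : r ∈ S) (hs : s ∈ S) {α β γ δ D : ℝ} (hD : 0 < D)
    (hα : 0 ≤ α) (hβ : 0 ≤ β) (hγ : 0 ≤ γ) (hδ : 0 ≤ δ) (hsum : α + β + γ + δ = D)
    (hx : ∀ l, D * x l = α * p l + β * q l + γ * r l + δ * s l) : x ∈ S := by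
  have h := hS.sum_mem (t := Finset.univ) (w := ![α / D, β / D, γ / D, δ / D])
    (z := ![p, q, r, s])
    (by intro i _; fin_cases i <;> simp <;> positivity)
    (by simp [Fin.sum_univ_four]; field_simp; exact hsum)
    (by intro i _; fin_cases i <;> simpa)
  convert h using 1
  ext l
  simp [Fin.sum_univ_four]
  field_simp
  linarith [hx l]

/-- The strict facet inequalities describe points of the pyramid. -/
lemma mem_pyramid (hz : ∀ i, w i 2 = 0) (ha : a 2 = 3)
    (ho : ∀ i, 0 < planeOrient (w i) (w (i + 1)) (w (i + 2))) {x : Fin 3 → ℝ}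
    (h0 : 0 < x 2) (hs : ∀ i, 0 < pyramidSide a (w i) (w (i + 1)) x) :
    x ∈ convexHull ℝ (insert a (Set.range w)) := by
  have hS := convex_convexHull ℝ (insert a (Set.range w))
  have hm : ∀ i, w i ∈ convexHull ℝ (insert a (Set.range w)) := fun i =>
    subset_convexHull _ _ (Set.mem_insert_of_mem _ ⟨i, rfl⟩)
  have hma : a ∈ convexHull ℝ (insert a (Set.range w)) :=
    subset_convexHull _ _ (Set.mem_insert _ _)
  have o0 : 0 < planeOrient (w 0) (w 1) (w 2) := ho 0
  have o2 : 0 < planeOrient (w 2) (w 3) (w 0) := ho 2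
  have s0 : 0 < pyramidSide a (w 0) (w 1) x := hs 0
  have s1 : 0 < pyramidSide a (w 1) (w 2) x := hs 1
  have s2 : 0 < pyramidSide a (w 2) (w 3) x := hs 2
  have s3 : 0 < pyramidSide a (w 3) (w 0) x := hs 3
  rcases le_total 0 (pyramidSide a (w 0) (w 2) x) with h | h
  · refine hS.combo_four_mem (hm 0) (hm 2) (hm 3) hma (α := pyramidSide a (w 2) (w 3) x)
      (β := pyramidSide a (w 3) (w 0) x) (γ := pyramidSide a (w 0) (w 2) x)
      (δ := x 2 * planeOrient (w 2) (w 3) (w 0)) (D := 3 * planeOrient (w 2) (w 3) (w 0))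
      (by positivity) s2.le s3.le h (by positivity) ?_ ?_
    · simp only [pyramidSide, planeOrient]; ring
    · intro l
      fin_cases l <;> simp [pyramidSide, planeOrient, hz, ha] <;> ring
  · refine hS.combo_four_mem (hm 0) (hm 1) (hm 2) hma (α := pyramidSide a (w 1) (w 2) x)
      (β := -pyramidSide a (w 0) (w 2) x) (γ := pyramidSide a (w 0) (w 1) x)
      (δ := x 2 * planeOrient (w 0) (w 1) (w 2)) (D := 3 * planeOrient (w 0) (w 1) (w 2))
      (by positivity) s1.le (by linarith) s0.le (by positivity) ?_ ?_
    · simp only [pyramidSide, planeOrient]; ring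
    · intro l
      fin_cases l <;> simp [pyramidSide, planeOrient, hz, ha] <;> ring

lemma mem_interior_pyramid (hz : ∀ i, w i 2 = 0) (ha : a 2 = 3)
    (ho : ∀ i, 0 < planeOrient (w i) (w (i + 1)) (w (i + 2))) {x : Fin 3 → ℝ}
    (h0 : 0 < x 2) (hs : ∀ i, 0 < pyramidSide a (w i) (w (i + 1)) x) :
    x ∈ interior (convexHull ℝ (insert a (Set.range w))) := by
  refine mem_interior.2 ⟨{x | 0 < x 2} ∩ ⋂ i, {x | 0 < pyramidSide a (w i) (w (i + 1)) x},
    ?_, ?_, h0, Set.mem_iInter.2 hs⟩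
  · rintro y ⟨hy, hy'⟩
    exact mem_pyramid hz ha ho hy (Set.mem_iInter.1 hy')
  · refine IsOpen.inter (isOpen_lt (by fun_prop) (by fun_prop)) (isOpen_iInter_of_finite fun i => ?_)
    exact isOpen_lt (by fun_prop) (by unfold pyramidSide; fun_prop)

/-- Side functions of an integral pyramid take integral values at integer points. -/
lemma exists_int_pyramidSide {a p q x : Fin 3 → ℝ} (ha : a ∈ intPts 3) (hp : p ∈ intPts 3)
    (hq : q ∈ intPts 3) (hx : x ∈ intPts 3) : ∃ n : ℤ, pyramidSide a p q x = n := by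
  choose a' ha using ha
  choose p' hp using hp
  choose q' hq using hq
  choose x' hx using hx
  refine ⟨(q' 0 - p' 0) * (3 * x' 1 - x' 2 * a' 1 - (3 - x' 2) * p' 1) -
    (q' 1 - p' 1) * (3 * x' 0 - x' 2 * a' 0 - (3 - x' 2) * p' 0), ?_⟩
  simp only [pyramidSide, ha, hp, hq, hx]
  push_cast
  ring

/-- A maximal lattice-free integral pyramid has an integer point in the relative interior of each
lateral facet. -/
lemma exists_intPts_facet (hz : ∀ i, w i 2 = 0) (ha : a 2 = 3)
    (ho : ∀ i, 0 < planeOrient (w i) (w (i + 1)) (w (i + 2)))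
    (hw : ∀ i, w i ∈ intPts 3) (haint : a ∈ intPts 3)
    (hP : MemM3 (convexHull ℝ (insert a (Set.range w)))) (i : Fin 4) :
    ∃ x ∈ intPts 3, 0 < x 2 ∧ x 2 < 3 ∧ pyramidSide a (w i) (w (i + 1)) x = 0 ∧
      ∀ j, j ≠ i → 0 < pyramidSide a (w j) (w (j + 1)) x := by
  by_contra! hcon
  obtain ⟨-, -, -, -, hfree, hmax⟩ := hP
  obtain ⟨K, hK⟩ : ∃ K : Set (Fin 3 → ℝ), K = {x | 0 ≤ x 2} ∩ {x | x 2 ≤ 3} ∩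
    ⋂ j, {x | (if j = i then -1 else 0) ≤ pyramidSide a (w j) (w (j + 1)) x} := ⟨_, rfl⟩
  have hKmem : ∀ x, x ∈ K ↔ (0 ≤ x 2 ∧ x 2 ≤ 3) ∧
      ∀ j, (if j = i then -1 else 0) ≤ pyramidSide a (w j) (w (j + 1)) x := by
    intro x; rw [hK]; simp
  have hconv : Convex ℝ K := by
    rw [hK]
    exact ((convex_halfSpace_ge (LinearMap.isLinear (LinearMap.proj 2)) 0).inter
      (convex_halfSpace_le (LinearMap.isLinear (LinearMap.proj 2)) 3)).inter
      (convex_iInter fun j => convex_le_pyramidSide _ _ _ _)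
  have hsub : convexHull ℝ (insert a (Set.range w)) ⊆ K := by
    intro x hx
    obtain ⟨h1, h2, h3⟩ := pyramid_subset hz ha ho hx
    refine (hKmem x).2 ⟨⟨h1, h2⟩, fun j => le_trans ?_ (h3 j)⟩
    split_ifs <;> norm_num
  have hKfree : interior K ∩ intPts 3 = ∅ := by
    rw [Set.eq_empty_iff_forall_notMem]
    rintro x ⟨hxK, hxint⟩
    have hx0 : 0 < x 2 := lt_of_mem_interior hxK (φ := fun y => y 2) (κ := 1) (fun _ => -1)
      (fun y hy => ((hKmem y).1 hy).1.1) (fun t => by simp; ring) one_pos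
    have hx3 : x 2 < 3 := by
      have := lt_of_mem_interior hxK (φ := fun y => -y 2) (c := -3) (κ := 1) (fun _ => 1)
        (fun y hy => neg_le_neg ((hKmem y).1 hy).1.2) (fun t => by simp; ring) one_pos
      simpa using this
    have hside : ∀ j, (if j = i then -1 else 0) < pyramidSide a (w j) (w (j + 1)) x := by
      intro j
      obtain ⟨v0, -, v2, -⟩ := pyramidSide_vertex (a := a) hz ho j
      refine lt_of_mem_interior hxK (w j - w (j + 2)) (fun y hy => ((hKmem y).1 hy).2 j)
        (fun t => ?_) v2
      rw [pyramidSide_add_smul, v0]; ring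
    have hpos : ∀ j, j ≠ i → 0 < pyramidSide a (w j) (w (j + 1)) x := fun j hj => by
      simpa [hj] using hside j
    have hnonneg : 0 ≤ pyramidSide a (w i) (w (i + 1)) x := by
      obtain ⟨n, hn⟩ := exists_int_pyramidSide haint (hw i) (hw (i + 1)) hxint
      have h1 := hside i
      rw [if_pos rfl, hn] at h1
      rw [hn]
      have : (-1 : ℤ) < n := by exact_mod_cast h1
      exact_mod_cast (show (0 : ℤ) ≤ n by lia)
    rcases hnonneg.eq_or_lt with h | h
    · obtain ⟨j, hj, hj'⟩ := hcon x hxint hx0 hx3 h.symm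
      exact absurd (hpos j hj) (not_lt.2 hj')
    · have : x ∈ interior (convexHull ℝ (insert a (Set.range w))) ∩ intPts 3 := by
        refine ⟨mem_interior_pyramid hz ha ho hx0 fun j => ?_, hxint⟩
        by_cases hj : j = i
        · rwa [hj]
        · exact hpos j hj
      rw [hfree] at this
      exact this
  have hPK := hmax K hconv hKfree hsub
  obtain ⟨v0, v1, v2, -⟩ := pyramidSide_vertex (a := a) hz ho i
  obtain ⟨m, hm⟩ : ∃ m, m = (1 / 2 : ℝ) • w i + (1 / 2 : ℝ) • w (i + 1) := ⟨_, rfl⟩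
  have hmside : ∀ j, pyramidSide a (w j) (w (j + 1)) m =
      1 / 2 * pyramidSide a (w j) (w (j + 1)) (w i) +
      1 / 2 * pyramidSide a (w j) (w (j + 1)) (w (i + 1)) := fun j => by
    rw [hm]
    exact pyramidSide_combo _ _ _ _ _ (by norm_num)
  have hm2 : m 2 = 0 := by simp [hm, hz]
  have hmpos : ∀ j, j ≠ i → 0 < pyramidSide a (w j) (w (j + 1)) m := by
    intro j hj
    rw [hmside]
    have n1 := pyramidSide_vertex_nonneg (a := a) hz ho j i
    have n2 := pyramidSide_vertex_nonneg (a := a) hz ho j (i + 1)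
    obtain ⟨-, -, u2, u3⟩ := pyramidSide_vertex (a := a) hz ho j
    have : i = j + 2 ∨ i = j + 3 ∨ i + 1 = j + 2 := by
      clear * - hj; revert i j; decide
    rcases this with h | h | h
    · rw [← h] at u2; linarith
    · rw [← h] at u3; linarith
    · rw [← h] at u2; linarith
  have hev : ∀ᶠ t : ℝ in nhdsWithin 0 (Ioi 0), ∀ j, (if j = i then -1 else 0) ≤
      pyramidSide a (w j) (w (j + 1)) (m + t • (m - w (i + 2))) := by
    refine Filter.eventually_all.2 fun j => ?_
    have hcont : Continuous fun t : ℝ =>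
        pyramidSide a (w j) (w (j + 1)) (m + t • (m - w (i + 2))) := by
      unfold pyramidSide; fun_prop
    have hlim := (hcont.tendsto 0).mono_left (nhdsWithin_le_nhds (s := Ioi 0))
    refine (hlim.eventually (lt_mem_nhds ?_)).mono fun t ht => ht.le
    rw [zero_smul, add_zero]
    split_ifs with h
    · rw [h, hmside, v0, v1]; norm_num
    · exact hmpos j h
  obtain ⟨t, ht, htpos⟩ := (hev.and self_mem_nhdsWithin).exists
  have hyK : m + t • (m - w (i + 2)) ∈ K :=
    (hKmem _).2 ⟨by simp [hm2, hz], ht⟩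
  rw [← hPK] at hyK
  have := (pyramid_subset hz ha ho hyK).2.2 i
  rw [pyramidSide_add_smul, hmside, v0, v1] at this
  have : 0 < t * pyramidSide a (w i) (w (i + 1)) (w (i + 2)) := mul_pos htpos v2
  linarith

/-- The integer points in the lateral facets can be chosen at height one. -/
lemma exists_intPts_facet_height_one (hz : ∀ i, w i 2 = 0) (ha : a 2 = 3)
    (ho : ∀ i, 0 < planeOrient (w i) (w (i + 1)) (w (i + 2)))
    (hw : ∀ i, w i ∈ intPts 3) (haint : a ∈ intPts 3)
    (hP : MemM3 (convexHull ℝ (insert a (Set.range w)))) (i : Fin 4) :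
    ∃ x ∈ intPts 3, x 2 = 1 ∧ pyramidSide a (w i) (w (i + 1)) x = 0 ∧
      ∀ j, j ≠ i → 0 < pyramidSide a (w j) (w (j + 1)) x := by
  obtain ⟨x, hx, h0, h3, hi, hj⟩ := exists_intPts_facet hz ha ho hw haint hP i
  obtain ⟨n, hn⟩ := hx 2
  rw [hn] at h0 h3
  have h0' : 0 < n := by exact_mod_cast h0
  have h3' : n < 3 := by exact_mod_cast h3
  obtain rfl | rfl : n = 1 ∨ n = 2 := by lia
  · exact ⟨x, hx, by simpa using hn, hi, hj⟩
  · have hside : ∀ j, pyramidSide a (w j) (w (j + 1)) (x + (1 : ℝ) • (x - a)) =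
        2 * pyramidSide a (w j) (w (j + 1)) x := fun j => by
      rw [pyramidSide_add_smul, pyramidSide_apex ha]; ring
    refine ⟨x + (1 : ℝ) • (x - a), fun l => ?_, ?_, ?_, fun j hji => ?_⟩
    · obtain ⟨k, hk⟩ := hx l
      obtain ⟨b, hb⟩ := haint l
      exact ⟨2 * k - b, by simp [hk, hb]; ring⟩
    · simp [hn, ha]; norm_num
    · rw [hside, hi, mul_zero]
    · rw [hside]
      have := hj j hji
      positivity

end Pyramid

/-- Twice the signed area of the lattice triangle `p q r`. -/
def latticeOrient (p q r : ℤ × ℤ) : ℤ :=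
  (q.1 - p.1) * (r.2 - p.2) - (q.2 - p.2) * (r.1 - p.1)

/-- The affine function of `x` whose zero line passes through `(2 / 3) v` and `(2 / 3) w`. -/
def latticeSide (v w x : ℤ × ℤ) : ℤ :=
  (w.1 - v.1) * (3 * x.2 - 2 * v.2) - (w.2 - v.2) * (3 * x.1 - 2 * v.1)

/-- If three consecutive edges of a convex chain `v₀ v₁ v₂ v₃` contain the points `p₀`, `p₁`, `p₂`,
each strictly on the inner side of the other two edges, then `p₀ p₁ p₂` is positively oriented. -/
lemma latticeOrient_pos {v₀ v₁ v₂ v₃ p₀ p₁ p₂ : ℤ × ℤ}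
    (ho₁ : 0 < latticeOrient v₀ v₁ v₂) (ho₂ : 0 < latticeOrient v₁ v₂ v₃)
    (h00 : latticeSide v₀ v₁ p₀ = 0) (h01 : 0 < latticeSide v₀ v₁ p₁)
    (h02 : 0 < latticeSide v₀ v₁ p₂) (h10 : 0 < latticeSide v₁ v₂ p₀)
    (h11 : latticeSide v₁ v₂ p₁ = 0) (h12 : 0 < latticeSide v₁ v₂ p₂)
    (h20 : 0 < latticeSide v₂ v₃ p₀) (h21 : 0 < latticeSide v₂ v₃ p₁)
    (h22 : latticeSide v₂ v₃ p₂ = 0) :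
    0 < latticeOrient p₀ p₁ p₂ := by
  have key : latticeSide v₀ v₁ p₀ * (latticeSide v₁ v₂ p₁ * latticeSide v₂ v₃ p₂
        - latticeSide v₁ v₂ p₂ * latticeSide v₂ v₃ p₁)
      - latticeSide v₀ v₁ p₁ * (latticeSide v₁ v₂ p₀ * latticeSide v₂ v₃ p₂
        - latticeSide v₁ v₂ p₂ * latticeSide v₂ v₃ p₀)
      + latticeSide v₀ v₁ p₂ * (latticeSide v₁ v₂ p₀ * latticeSide v₂ v₃ p₁
        - latticeSide v₁ v₂ p₁ * latticeSide v₂ v₃ p₀)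
      = 18 * (latticeOrient v₀ v₁ v₂ * latticeOrient v₁ v₂ v₃) * latticeOrient p₀ p₁ p₂ := by
    simp only [latticeSide, latticeOrient]; ring
  rw [h00, h11, h22] at key
  have h1 := mul_pos (mul_pos h01 h12) h20
  have h2 := mul_pos (mul_pos h02 h10) h21
  have h3 : 0 < 18 * (latticeOrient v₀ v₁ v₂ * latticeOrient v₁ v₂ v₃) := by positivity
  refine pos_of_mul_pos_right (b := latticeOrient p₀ p₁ p₂) ?_ h3.le
  rw [← key]
  linarith

/-- A lattice triangle of normalized area at least two contains a lattice point
which is not a vertex. -/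
lemma exists_lattice_point_of_one_lt {p q r : ℤ × ℤ} (hD : 1 < latticeOrient p q r) :
    ∃ (x : ℤ × ℤ) (α β γ : ℤ), 0 ≤ α ∧ 0 ≤ β ∧ 0 ≤ γ ∧
      α + β + γ = latticeOrient p q r ∧
      α < latticeOrient p q r ∧ β < latticeOrient p q r ∧ γ < latticeOrient p q r ∧
      latticeOrient p q r * x.1 = α * p.1 + β * q.1 + γ * r.1 ∧
      latticeOrient p q r * x.2 = α * p.2 + β * q.2 + γ * r.2 := by
  obtain ⟨p1, p2⟩ := p
  obtain ⟨q1, q2⟩ := q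
  obtain ⟨r1, r2⟩ := r
  obtain ⟨D, hDdef⟩ : ∃ D, D = latticeOrient (p1, p2) (q1, q2) (r1, r2) := ⟨_, rfl⟩
  rw [← hDdef] at hD ⊢
  simp only [latticeOrient] at hDdef ⊢
  have key : ∃ y1 y2 : ℤ,
      ¬ (D ∣ y1 * (r2 - p2) - y2 * (r1 - p1) ∧ D ∣ (q1 - p1) * y2 - (q2 - p2) * y1) := by
    by_contra! hcon
    obtain ⟨⟨a, ha⟩, ⟨b, hb⟩⟩ := hcon 1 0
    obtain ⟨⟨c, hc⟩, ⟨d, hd⟩⟩ := hcon 0 1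
    have h1 : D * 1 = D * (D * (a * d - b * c)) := by
      have : D = (D * d) * (D * a) - (D * b) * (D * c) := by
        rw [← ha, ← hb, ← hc, ← hd]; rw [hDdef]; ring
      linear_combination this
    have h2 := mul_left_cancel₀ (by lia) h1
    have : D ∣ 1 := ⟨_, h2⟩
    have := Int.le_of_dvd one_pos this
    lia
  obtain ⟨y1, y2, hy⟩ := key
  obtain ⟨A, hA⟩ : ∃ A, A = y1 * (r2 - p2) - y2 * (r1 - p1) := ⟨_, rfl⟩
  obtain ⟨B, hB⟩ : ∃ B, B = (q1 - p1) * y2 - (q2 - p2) * y1 := ⟨_, rfl⟩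
  rw [← hA, ← hB, Int.dvd_iff_emod_eq_zero, Int.dvd_iff_emod_eq_zero] at hy
  have hA0 := Int.emod_nonneg A (show D ≠ 0 by lia)
  have hB0 := Int.emod_nonneg B (show D ≠ 0 by lia)
  have hA1 := Int.emod_lt_of_pos A (show 0 < D by lia)
  have hB1 := Int.emod_lt_of_pos B (show 0 < D by lia)
  have hAe := Int.emod_add_mul_ediv A D
  have hBe := Int.emod_add_mul_ediv B D
  generalize A % D = A' at *
  generalize B % D = B' at *
  generalize A / D = A'' at *
  generalize B / D = B'' at *
  have e1 : D * y1 = A * (q1 - p1) + B * (r1 - p1) := by rw [hDdef, hA, hB]; ring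
  have e2 : D * y2 = A * (q2 - p2) + B * (r2 - p2) := by rw [hDdef, hA, hB]; ring
  by_cases hAB : A' + B' ≤ D
  · refine ⟨(p1 + y1 - A'' * (q1 - p1) - B'' * (r1 - p1),
      p2 + y2 - A'' * (q2 - p2) - B'' * (r2 - p2)), D - A' - B', A', B',
      by lia, by lia, by lia, by lia, by lia, by lia, by lia, ?_, ?_⟩
    · linear_combination e1 - (q1 - p1) * hAe - (r1 - p1) * hBe
    · linear_combination e2 - (q2 - p2) * hAe - (r2 - p2) * hBe
  · refine ⟨(q1 + r1 - p1 - (y1 - A'' * (q1 - p1) - B'' * (r1 - p1)),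
      q2 + r2 - p2 - (y2 - A'' * (q2 - p2) - B'' * (r2 - p2))), A' + B' - D, D - A', D - B',
      by lia, by lia, by lia, by lia, by lia, by lia, by lia, ?_, ?_⟩
    · linear_combination -e1 + (q1 - p1) * hAe + (r1 - p1) * hBe
    · linear_combination -e2 + (q2 - p2) * hAe + (r2 - p2) * hBe

/-- The lattice points on three edges, each strictly inside the other half-planes, span a
unimodular triangle as soon as no lattice point is strictly inside all the half-planes. -/
lemma latticeOrient_eq_one {ι : Type*} {v w : ι → ℤ × ℤ} {p q r : ℤ × ℤ}
    (hemp : ¬ ∃ x, ∀ i, 0 < latticeSide (v i) (w i) x)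
    (hpos : 0 < latticeOrient p q r)
    (hp : ∀ i, 0 ≤ latticeSide (v i) (w i) p) (hq : ∀ i, 0 ≤ latticeSide (v i) (w i) q)
    (hr : ∀ i, 0 ≤ latticeSide (v i) (w i) r)
    (hpq : ∀ i, 0 < latticeSide (v i) (w i) p ∨ 0 < latticeSide (v i) (w i) q)
    (hqr : ∀ i, 0 < latticeSide (v i) (w i) q ∨ 0 < latticeSide (v i) (w i) r)
    (hrp : ∀ i, 0 < latticeSide (v i) (w i) r ∨ 0 < latticeSide (v i) (w i) p) :
    latticeOrient p q r = 1 := by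
  by_contra hne
  obtain ⟨x, α, β, γ, hα, hβ, hγ, hs, hα', hβ', hγ', e1, e2⟩ :=
    exists_lattice_point_of_one_lt (p := p) (q := q) (r := r) (by lia)
  refine hemp ⟨x, fun i => ?_⟩
  have e : latticeOrient p q r * latticeSide (v i) (w i) x
      = α * latticeSide (v i) (w i) p + β * latticeSide (v i) (w i) q
        + γ * latticeSide (v i) (w i) r := by
    generalize latticeOrient p q r = D at *
    simp only [latticeSide]
    linear_combination 3 * ((w i).1 - (v i).1) * e2 - 3 * ((w i).2 - (v i).2) * e1
      - (2 * ((w i).2 - (v i).2) * (v i).1 - 2 * ((w i).1 - (v i).1) * (v i).2) * hs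
  refine pos_of_mul_pos_right (a := latticeOrient p q r) ?_ hpos.le
  rw [e]
  have hp := hp i
  have hq := hq i
  have hr := hr i
  have hpq := hpq i
  have hqr := hqr i
  have hrp := hrp i
  generalize latticeSide (v i) (w i) p = a at *
  generalize latticeSide (v i) (w i) q = b at *
  generalize latticeSide (v i) (w i) r = c at *
  have h1 := mul_nonneg hα hp
  have h2 := mul_nonneg hβ hq
  have h3 := mul_nonneg hγ hr
  by_contra hle
  have z1 : α * a = 0 := by lia
  have z2 : β * b = 0 := by lia
  have z3 : γ * c = 0 := by lia
  rw [mul_eq_zero] at z1 z2 z3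
  lia

/-- A lattice quadrilateral circumscribed about the square with vertices `(0, 0)`, `(3/2, 0)`,
`(3/2, 3/2)`, `(0, 3/2)` is unique. -/
lemma circumscribed_unique {X₁ Y₁ X₂ Y₂ X₃ Y₃ X₄ Y₄ : ℤ}
    (x12 : X₁ < X₂) (x23 : X₂ < X₃) (x43 : X₄ < X₃) (x14 : X₁ < X₄)
    (y21 : Y₂ < Y₁) (y14 : Y₁ < Y₄) (y23 : Y₂ < Y₃) (y34 : Y₃ < Y₄)
    (E₁ : X₁ * Y₂ = X₂ * Y₁) (E₂ : (2 * X₂ - 3) * Y₃ = Y₂ * (2 * X₃ - 3))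
    (E₃ : (2 * X₃ - 3) * (2 * Y₄ - 3) = (2 * X₄ - 3) * (2 * Y₃ - 3))
    (E₄ : X₄ * (2 * Y₁ - 3) = (2 * Y₄ - 3) * X₁) :
    X₁ = -1 ∧ Y₁ = 1 ∧ X₂ = 1 ∧ Y₂ = -1 ∧ X₃ = 2 ∧ Y₃ = 1 ∧ X₄ = 1 ∧ Y₄ = 2 := by
  have hY2 : Y₂ < 0 := by
    by_contra! h
    have h1 : X₂ ≤ 0 := by
      by_contra! h'
      nlinarith [mul_pos h' (sub_pos.2 y21), mul_nonneg h (sub_pos.2 x12).le]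
    nlinarith [mul_pos (show 0 < 3 - 2 * X₂ by lia) (sub_pos.2 y23),
      mul_nonneg h (sub_pos.2 x23).le]
  have hX2 : X₂ = 1 := by
    have h1 : 0 < X₂ := by
      by_contra! h'
      nlinarith [mul_nonneg (neg_nonneg.2 h') (sub_pos.2 y21).le,
        mul_pos (neg_pos.2 hY2) (sub_pos.2 x12)]
    have h2 : 2 * X₂ < 3 := by
      by_contra! h'
      nlinarith [mul_nonneg (sub_nonneg.2 h') (sub_pos.2 y23).le,
        mul_pos (neg_pos.2 hY2) (sub_pos.2 x23)]
    lia
  have hX1 : X₁ < 0 := by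
    by_contra! h
    have h1 : Y₁ ≤ 0 := by
      by_contra! h'
      nlinarith [mul_pos h' (sub_pos.2 x12), mul_nonneg h (sub_pos.2 y21).le]
    nlinarith [mul_pos (show 0 < 3 - 2 * Y₁ by lia) (sub_pos.2 x14),
      mul_nonneg h (sub_pos.2 y14).le]
  have hY1 : Y₁ = 1 := by
    have h1 : 0 < Y₁ := by
      by_contra! h'
      nlinarith [mul_nonneg (neg_nonneg.2 h') (sub_pos.2 x12).le,
        mul_pos (neg_pos.2 hX1) (sub_pos.2 y21)]
    have h2 : 2 * Y₁ < 3 := by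
      by_contra! h'
      nlinarith [mul_nonneg (sub_nonneg.2 h') (sub_pos.2 x14).le,
        mul_pos (neg_pos.2 hX1) (sub_pos.2 y14)]
    lia
  subst hX2 hY1
  have hX1' : X₁ = -1 := by nlinarith
  subst hX1'
  have hY2' : Y₂ = -1 := by lia
  subst hY2'
  have a : Y₃ = 2 * X₃ - 3 := by lia
  have b : X₄ = 2 * Y₄ - 3 := by lia
  subst a b
  have h1 : X₃ = 2 := by
    have h : (2 * X₃ - 3) * (2 * Y₄ - 3) = (4 * Y₄ - 9) * (4 * X₃ - 9) := by
      linear_combination E₃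
    nlinarith
  subst h1
  lia

/-- Three consecutive lattice points on the edges span a unimodular triangle. -/
lemma latticeOrient_consecutive_eq_one {v p : Fin 4 → ℤ × ℤ}
    (ho : ∀ i, 0 < latticeOrient (v i) (v (i + 1)) (v (i + 2)))
    (h0 : ∀ i, latticeSide (v i) (v (i + 1)) (p i) = 0)
    (hpos : ∀ i j, j ≠ i → 0 < latticeSide (v i) (v (i + 1)) (p j))
    (hemp : ¬ ∃ x, ∀ i, 0 < latticeSide (v i) (v (i + 1)) x) (i : Fin 4) :
    latticeOrient (p i) (p (i + 1)) (p (i + 2)) = 1 := by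
  have hnonneg : ∀ i j, 0 ≤ latticeSide (v i) (v (i + 1)) (p j) := by
    intro i j
    by_cases h : j = i
    · rw [h, h0]
    · exact (hpos i j h).le
  have hor : ∀ {j k : Fin 4}, j ≠ k → ∀ i, 0 < latticeSide (v i) (v (i + 1)) (p j) ∨
      0 < latticeSide (v i) (v (i + 1)) (p k) := by
    intro j k hjk i
    by_cases h : j = i
    · exact Or.inr (hpos i k (h ▸ hjk.symm))
    · exact Or.inl (hpos i j h)
  have n1 : i ≠ i + 1 := by revert i; decide
  have n2 : i ≠ i + 2 := by revert i; decide
  have n3 : i + 1 ≠ i + 2 := by revert i; decide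
  have e1 : i + 1 + 1 = i + 2 := by revert i; decide
  have e2 : i + 1 + 2 = i + 2 + 1 := by revert i; decide
  refine latticeOrient_eq_one (v := v) (w := fun i => v (i + 1)) hemp ?_ (hnonneg · _)
    (hnonneg · _) (hnonneg · _) (hor n1) (hor n3) (hor n2.symm)
  have hb := hpos (i + 1)
  have ho' := ho (i + 1)
  have h0' := h0 (i + 1)
  rw [e1] at hb ho' h0'
  rw [e2] at ho'
  exact latticeOrient_pos (ho i) ho' (h0 i) (hpos i _ n1.symm) (hpos i _ n2.symm)
    (hb _ n1) h0' (hb _ n3.symm) (hpos (i + 2) _ n2) (hpos (i + 2) _ n3) (h0 (i + 2))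

/-- The classification of the quadrilaterals, when the point on the edge `v 0`, `v 1` is even. -/
lemma lattice_quadrilateral_of_even {v p : Fin 4 → ℤ × ℤ} {k : ℤ × ℤ}
    (h0 : ∀ i, latticeSide (v i) (v (i + 1)) (p i) = 0)
    (hpos : ∀ i j, j ≠ i → 0 < latticeSide (v i) (v (i + 1)) (p j))
    (hone : ∀ i, latticeOrient (p i) (p (i + 1)) (p (i + 2)) = 1)
    (hk : p 0 = 2 • k) :
    ∃ e f : ℤ × ℤ, e.1 * f.2 - e.2 * f.1 = 1 ∧ v 0 = 3 • k - e + f ∧ v 1 = 3 • k + e - f ∧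
      v 2 = 3 • k + 2 • e + f ∧ v 3 = 3 • k + e + 2 • f := by
  obtain ⟨e, he⟩ : ∃ e, p 1 = 2 • k + e := ⟨p 1 - 2 • k, by abel⟩
  obtain ⟨f, hf⟩ : ∃ f, p 3 = 2 • k + f := ⟨p 3 - 2 • k, by abel⟩
  obtain ⟨g, hg⟩ : ∃ g, p 2 = 2 • k + g := ⟨p 2 - 2 • k, by abel⟩
  have o0 : latticeOrient (p 0) (p 1) (p 2) = 1 := hone 0
  have o2 : latticeOrient (p 2) (p 3) (p 0) = 1 := hone 2
  have o3 : latticeOrient (p 3) (p 0) (p 1) = 1 := hone 3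
  obtain ⟨k1, k2⟩ := k
  obtain ⟨e1, e2⟩ := e
  obtain ⟨f1, f2⟩ := f
  obtain ⟨g1, g2⟩ := g
  rw [hk, he, hg] at o0
  rw [hk, hf, hg] at o2
  rw [hk, he, hf] at o3
  simp only [latticeOrient, Prod.smul_mk, Prod.mk_add_mk, nsmul_eq_mul, Nat.cast_ofNat]
    at o0 o2 o3
  have hdet : e1 * f2 - e2 * f1 = 1 := by linear_combination o3
  have hg1 : g1 = e1 + f1 := by
    linear_combination e1 * o2 + f1 * o0 - g1 * hdet
  have hg2 : g2 = e2 + f2 := by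
    linear_combination e2 * o2 + f2 * o0 - g2 * hdet
  subst hg1 hg2
  have hv : ∀ i, ∃ X Y : ℤ, v i = (3 * k1 + X * e1 + Y * f1, 3 * k2 + X * e2 + Y * f2) := by
    intro i
    refine ⟨((v i).1 - 3 * k1) * f2 - ((v i).2 - 3 * k2) * f1,
      e1 * ((v i).2 - 3 * k2) - e2 * ((v i).1 - 3 * k1), Prod.ext ?_ ?_⟩
    · simp only
      linear_combination -((v i).1 - 3 * k1) * hdet
    · simp only
      linear_combination -((v i).2 - 3 * k2) * hdet
  choose X Y hXY using hv
  have side : ∀ i j (x y : ℤ), latticeSide (v i) (v j)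
      (2 * k1 + x * e1 + y * f1, 2 * k2 + x * e2 + y * f2) =
      (X j - X i) * (3 * y - 2 * Y i) - (Y j - Y i) * (3 * x - 2 * X i) := by
    intro i j x y
    rw [hXY, hXY]
    simp only [latticeSide]
    linear_combination ((X j - X i) * (3 * y - 2 * Y i) - (Y j - Y i) * (3 * x - 2 * X i)) * hdet
  have p0 : p 0 = (2 * k1 + 0 * e1 + 0 * f1, 2 * k2 + 0 * e2 + 0 * f2) := by
    rw [hk]; ext <;> simp
  have p1 : p 1 = (2 * k1 + 1 * e1 + 0 * f1, 2 * k2 + 1 * e2 + 0 * f2) := by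
    rw [he]; ext <;> simp
  have p2 : p 2 = (2 * k1 + 1 * e1 + 1 * f1, 2 * k2 + 1 * e2 + 1 * f2) := by
    rw [hg]; ext <;> simp <;> ring
  have p3 : p 3 = (2 * k1 + 0 * e1 + 1 * f1, 2 * k2 + 0 * e2 + 1 * f2) := by
    rw [hf]; ext <;> simp
  have a0 : latticeSide (v 0) (v 1) (p 0) = 0 := h0 0
  have a1 : latticeSide (v 1) (v 2) (p 1) = 0 := h0 1
  have a2 : latticeSide (v 2) (v 3) (p 2) = 0 := h0 2
  have a3 : latticeSide (v 3) (v 0) (p 3) = 0 := h0 3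
  have b0 : 0 < latticeSide (v 0) (v 1) (p 1) := hpos 0 1 (by decide)
  have b1 : 0 < latticeSide (v 1) (v 2) (p 2) := hpos 1 2 (by decide)
  have b2 : 0 < latticeSide (v 2) (v 3) (p 3) := hpos 2 3 (by decide)
  have b3 : 0 < latticeSide (v 3) (v 0) (p 0) := hpos 3 0 (by decide)
  have c0 : 0 < latticeSide (v 0) (v 1) (p 3) := hpos 0 3 (by decide)
  have c1 : 0 < latticeSide (v 1) (v 2) (p 0) := hpos 1 0 (by decide)
  have c2 : 0 < latticeSide (v 2) (v 3) (p 1) := hpos 2 1 (by decide)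
  have c3 : 0 < latticeSide (v 3) (v 0) (p 2) := hpos 3 2 (by decide)
  rw [p0, side] at a0 b3 c1
  rw [p1, side] at a1 b0 c2
  rw [p2, side] at a2 b1 c3
  rw [p3, side] at a3 b2 c0
  obtain ⟨X0, Y0, X1, Y1, X2, Y2, X3, Y3⟩ := circumscribed_unique (X₁ := X 0) (Y₁ := Y 0)
    (X₂ := X 1) (Y₂ := Y 1) (X₃ := X 2) (Y₃ := Y 2) (X₄ := X 3) (Y₄ := Y 3)
    (by linarith) (by linarith) (by linarith) (by linarith) (by linarith) (by linarith)
    (by linarith) (by linarith) (by linarith) (by linarith) (by linarith) (by linarith)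
  refine ⟨(e1, e2), (f1, f2), hdet, ?_, ?_, ?_, ?_⟩ <;> rw [hXY]
  · rw [X0, Y0]; ext <;> simp <;> ring
  · rw [X1, Y1]; ext <;> simp <;> ring
  · rw [X2, Y2]; ext <;> simp
  · rw [X3, Y3]; ext <;> simp

/-- Some vertex of a unimodular lattice parallelogram is even. -/
lemma exists_even_vertex {p : Fin 4 → ℤ × ℤ}
    (hone : ∀ i, latticeOrient (p i) (p (i + 1)) (p (i + 2)) = 1) :
    ∃ (j : Fin 4) (k : ℤ × ℤ), p j = 2 • k := by
  have o0 : latticeOrient (p 0) (p 1) (p 2) = 1 := hone 0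
  have o2 : latticeOrient (p 2) (p 3) (p 0) = 1 := hone 2
  have o3 : latticeOrient (p 3) (p 0) (p 1) = 1 := hone 3
  rcases hp0 : p 0 with ⟨a1, a2⟩
  rcases hp1 : p 1 with ⟨b1, b2⟩
  rcases hp2 : p 2 with ⟨c1, c2⟩
  rcases hp3 : p 3 with ⟨d1, d2⟩
  rw [hp0, hp1, hp2] at o0
  rw [hp0, hp2, hp3] at o2
  rw [hp0, hp1, hp3] at o3
  simp only [latticeOrient] at o0 o2 o3
  have hdet : (b1 - a1) * (d2 - a2) - (b2 - a2) * (d1 - a1) = 1 := by linear_combination o3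
  have hc1 : c1 = b1 + d1 - a1 := by
    linear_combination (b1 - a1) * o2 + (d1 - a1) * o0 - (c1 - a1) * hdet
  have hc2 : c2 = b2 + d2 - a2 := by
    linear_combination (b2 - a2) * o2 + (d2 - a2) * o0 - (c2 - a2) * hdet
  obtain ⟨X, hX⟩ : ∃ X, X = a1 * (d2 - a2) - a2 * (d1 - a1) := ⟨_, rfl⟩
  obtain ⟨Y, hY⟩ : ∃ Y, Y = (b1 - a1) * a2 - (b2 - a2) * a1 := ⟨_, rfl⟩
  have ha1 : a1 = X * (b1 - a1) + Y * (d1 - a1) := by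
    rw [hX, hY]; linear_combination -a1 * hdet
  have ha2 : a2 = X * (b2 - a2) + Y * (d2 - a2) := by
    rw [hX, hY]; linear_combination -a2 * hdet
  obtain ⟨x, rfl | rfl⟩ := Int.even_or_odd' X <;> obtain ⟨y, rfl | rfl⟩ := Int.even_or_odd' Y
  · refine ⟨0, (x * (b1 - a1) + y * (d1 - a1), x * (b2 - a2) + y * (d2 - a2)), ?_⟩
    rw [hp0]; ext <;> simp <;> linarith
  · refine ⟨3, (x * (b1 - a1) + (y + 1) * (d1 - a1), x * (b2 - a2) + (y + 1) * (d2 - a2)), ?_⟩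
    rw [hp3]; ext <;> simp <;> linarith
  · refine ⟨1, ((x + 1) * (b1 - a1) + y * (d1 - a1), (x + 1) * (b2 - a2) + y * (d2 - a2)), ?_⟩
    rw [hp1]; ext <;> simp <;> linarith
  · refine ⟨2, ((x + 1) * (b1 - a1) + (y + 1) * (d1 - a1),
      (x + 1) * (b2 - a2) + (y + 1) * (d2 - a2)), ?_⟩
    rw [hp2]; ext <;> simp <;> linarith

/-- A lattice quadrilateral all of whose edges carry a point of `(3/2)ℤ²` in the relative interior,
but with no such point in the interior, is unimodularly equivalent to a fixed one. -/
lemma lattice_quadrilateral {v p : Fin 4 → ℤ × ℤ}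
    (ho : ∀ i, 0 < latticeOrient (v i) (v (i + 1)) (v (i + 2)))
    (h0 : ∀ i, latticeSide (v i) (v (i + 1)) (p i) = 0)
    (hpos : ∀ i j, j ≠ i → 0 < latticeSide (v i) (v (i + 1)) (p j))
    (hemp : ¬ ∃ x, ∀ i, 0 < latticeSide (v i) (v (i + 1)) x) :
    ∃ (j : Fin 4) (k e f : ℤ × ℤ), e.1 * f.2 - e.2 * f.1 = 1 ∧
      v j = 3 • k - e + f ∧ v (j + 1) = 3 • k + e - f ∧
      v (j + 2) = 3 • k + 2 • e + f ∧ v (j + 3) = 3 • k + e + 2 • f := by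
  have hone := latticeOrient_consecutive_eq_one ho h0 hpos hemp
  obtain ⟨j, k, hk⟩ := exists_even_vertex hone
  have := lattice_quadrilateral_of_even (v := fun i => v (j + i)) (p := fun i => p (j + i))
    (k := k) (fun i => by simpa only [add_assoc] using h0 (j + i))
    (fun i i' h => by simpa only [add_assoc] using hpos (j + i) (j + i') (by simpa using h))
    (fun i => by simpa only [add_assoc] using hone (j + i)) (by simpa using hk)
  obtain ⟨e, f, h, h1, h2, h3, h4⟩ := this
  exact ⟨j, k, e, f, h, by simpa using h1, h2, h3, h4⟩

/-- The apex and the vertices of a horizontal base are extreme points of a pyramid. -/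
lemma extremePoints_base_subset {F : Set (Fin 3 → ℝ)} {a : Fin 3 → ℝ} (hF : Convex ℝ F)
    (hne : F.Nonempty) (hz : F ⊆ {x : Fin 3 → ℝ | x 2 = 0}) (ha : a 2 = 3) :
    insert a (Set.extremePoints ℝ F) ⊆ Set.extremePoints ℝ (convexHull ℝ (insert a F)) := by
  have hlevel : ∀ x ∈ convexHull ℝ (insert a F), ∃ f ∈ F, ∃ s t : ℝ, 0 ≤ s ∧ 0 ≤ t ∧
      s + t = 1 ∧ x = s • a + t • f ∧ x 2 = 3 * s := by
    intro x hx
    rw [convexHull_insert hne, hF.convexHull_eq, convexJoin_singleton_left] at hx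
    obtain ⟨f, hf, s, t, hs, ht, hst, rfl⟩ := Set.mem_iUnion₂.1 hx
    have hf2 : f 2 = 0 := hz hf
    exact ⟨f, hf, s, t, hs, ht, hst, rfl, by simp [hf2, ha]; ring⟩
  have hbase : IsExposed ℝ (convexHull ℝ (insert a F)) F := by
    intro _
    refine ⟨-ContinuousLinearMap.proj (R := ℝ) (φ := fun _ : Fin 3 => ℝ) 2, ?_⟩
    ext x
    constructor
    · intro hx
      refine ⟨subset_convexHull _ _ (Set.mem_insert_of_mem _ hx), fun y hy => ?_⟩
      obtain ⟨f, -, s, t, hs, -, -, -, h2⟩ := hlevel y hy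
      have hx2 : x 2 = 0 := hz hx
      simp [hx2, h2, hs]
    · rintro ⟨hx, hmax⟩
      obtain ⟨f, hf, s, t, hs, -, hst, hxe, h2⟩ := hlevel x hx
      obtain ⟨g, hg⟩ := hne
      have hg2 : g 2 = 0 := hz hg
      have h3 := hmax g (subset_convexHull _ _ (Set.mem_insert_of_mem _ hg))
      simp [hg2, h2] at h3
      have hs0 : s = 0 := by linarith
      have ht1 : t = 1 := by linarith
      rw [hxe, hs0, ht1]
      simpa using hf
  have hapex : IsExposed ℝ (convexHull ℝ (insert a F)) {a} := by
    intro _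
    refine ⟨ContinuousLinearMap.proj (R := ℝ) (φ := fun _ : Fin 3 => ℝ) 2, ?_⟩
    ext x
    constructor
    · rintro rfl
      refine ⟨subset_convexHull _ _ (Set.mem_insert _ _), fun y hy => ?_⟩
      obtain ⟨f, -, s, t, hs, ht, hst, -, h2⟩ := hlevel y hy
      simp only [ContinuousLinearMap.proj_apply, h2, ha]
      linarith
    · rintro ⟨hx, hmax⟩
      obtain ⟨f, hf, s, t, hs, ht, hst, hxe, h2⟩ := hlevel x hx
      have h3 := hmax a (subset_convexHull _ _ (Set.mem_insert _ _))
      simp only [ContinuousLinearMap.proj_apply, h2, ha] at h3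
      have ht0 : t = 0 := by linarith
      have hs1 : s = 1 := by linarith
      rw [hxe, hs1, ht0]
      simp
  exact Set.insert_subset (isExtreme_singleton.1 hapex.isExtreme)
    hbase.isExtreme.extremePoints_subset_extremePoints

/-- Affine images of convex hulls. -/
lemma affMap_image_convexHull {d : ℕ} (U : Matrix (Fin d) (Fin d) ℤ) (t : Fin d → ℝ)
    (S : Set (Fin d → ℝ)) : affMap U t '' convexHull ℝ S = convexHull ℝ (affMap U t '' S) := by
  have h : affMap U t = ((Matrix.mulVecLin (U.map (Int.cast : ℤ → ℝ))).toAffineMap +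
      AffineMap.const ℝ (Fin d → ℝ) t : (Fin d → ℝ) →ᵃ[ℝ] (Fin d → ℝ)) := by
    ext x i
    simp [affMap, Matrix.mulVec, dotProduct]
  rw [h, AffineMap.image_convexHull]

/-- A maximal lattice-free integral quadrangular pyramid in `ℝ³` with base in the plane
`x₃ = 0` and apex at height `3` is, up to a unimodular transformation, the pyramid `M₉`. -/
theorem M3_pyramid_height_three (P F : Set (Fin 3 → ℝ)) (a : Fin 3 → ℝ)
    (hP : MemM3 P)
    (hFpoly : ∃ V : Finset (Fin 3 → ℝ), F = convexHull ℝ (V : Set (Fin 3 → ℝ)))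
    (hFquad : (Set.extremePoints ℝ F).ncard = 4)
    (hFplane : F ⊆ {x : Fin 3 → ℝ | x 2 = 0})
    (ha : a 2 = 3)
    (hPyr : P = convexHull ℝ (F ∪ {a})) :
    ∃ (U : Matrix (Fin 3) (Fin 3) ℤ) (v : Fin 3 → ℤ),
      |U.det| = 1 ∧ P = affMap U (fun i => (v i : ℝ)) '' M9 := by
  obtain ⟨w, hwext, hFw, ho⟩ := exists_cyclic_labelling hFpoly hFquad hFplane
  have hz : ∀ i, w i 2 = 0 := fun i => hFplane (hwext i).1
  have hPw : P = convexHull ℝ (insert a (Set.range w)) := by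
    rw [hPyr, hFw, Set.union_comm, convexHull_convexHull_union_right, Set.singleton_union]
  have hext : insert a (Set.extremePoints ℝ F) ⊆ intPts 3 := by
    refine (extremePoints_base_subset (hFw ▸ convex_convexHull ℝ _) ⟨_, (hwext 0).1⟩
      hFplane ha).trans ?_
    rw [← Set.singleton_union, Set.union_comm, ← hPyr, hP.2.2.1]
    exact extremePoints_convexHull_subset.trans Set.inter_subset_right
  have haint : a ∈ intPts 3 := hext (Set.mem_insert _ _)
  have hwint : ∀ i, w i ∈ intPts 3 := fun i => hext (Set.mem_insert_of_mem _ (hwext i))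
  rw [hPw] at hP
  choose x hxint hx1 hx0 hxpos using exists_intPts_facet_height_one hz ha ho hwint haint hP
  choose a' ha' using haint
  choose w' hw' using hwint
  choose x' hx' using hxint
  have hside : ∀ i j (y : Fin 3 → ℝ) (q : ℤ × ℤ), y 0 = q.1 + a' 0 → y 1 = q.2 + a' 1 →
      y 2 = 1 → pyramidSide a (w i) (w j) y = latticeSide (w' i 0 - a' 0, w' i 1 - a' 1)
        (w' j 0 - a' 0, w' j 1 - a' 1) q := by
    intro i j y q h0 h1 h2
    simp only [pyramidSide, latticeSide, h0, h1, h2, hw', ha']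
    push_cast
    ring
  have hsidex : ∀ i k, pyramidSide a (w i) (w (i + 1)) (x k) =
      latticeSide (w' i 0 - a' 0, w' i 1 - a' 1) (w' (i + 1) 0 - a' 0, w' (i + 1) 1 - a' 1)
        (x' k 0 - a' 0, x' k 1 - a' 1) := fun i k =>
    hside _ _ _ _ (by simp [hx']) (by simp [hx']) (hx1 k)
  obtain ⟨j, k, e, f, hdet, h0, h1, h2, h3⟩ := lattice_quadrilateral
    (v := fun i => (w' i 0 - a' 0, w' i 1 - a' 1))
    (p := fun i => (x' i 0 - a' 0, x' i 1 - a' 1))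
    (fun i => by
      have := ho i
      simp only [planeOrient, hw'] at this
      have h : 0 < (w' (i + 1) 0 - w' i 0) * (w' (i + 2) 1 - w' i 1) -
        (w' (i + 1) 1 - w' i 1) * (w' (i + 2) 0 - w' i 0) := by exact_mod_cast this
      simp only [latticeOrient]
      linarith)
    (fun i => by
      have := hx0 i
      rw [hsidex] at this
      exact_mod_cast this)
    (fun i k hk => by
      have := hxpos k i hk.symm
      rw [hsidex] at this
      exact_mod_cast this)
    (fun ⟨q, hq⟩ => by
      have hmem : (![q.1 + a' 0, q.2 + a' 1, 1] : Fin 3 → ℝ) ∈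
          interior (convexHull ℝ (insert a (Set.range w))) ∩ intPts 3 := by
        refine ⟨mem_interior_pyramid hz ha ho (by simp) fun i => ?_, fun l => ?_⟩
        · rw [hside i (i + 1) _ q (by simp) (by simp) (by simp)]
          exact_mod_cast hq i
        · fin_cases l
          · exact ⟨q.1 + a' 0, by simp⟩
          · exact ⟨q.2 + a' 1, by simp⟩
          · exact ⟨1, by simp⟩
      rw [hP.2.2.2.2.1] at hmem
      exact hmem)
  have hwcoord : ∀ i (q : ℤ × ℤ), (w' i 0 - a' 0, w' i 1 - a' 1) = q →
      w i = ![(q.1 : ℝ) + a' 0, q.2 + a' 1, 0] := by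
    rintro i _ rfl
    ext l
    fin_cases l
    · simp [hw']
    · simp [hw']
    · simp [hz]
  have hacoord : a = ![(a' 0 : ℝ), a' 1, 3] := by
    ext l
    fin_cases l
    · exact ha' 0
    · exact ha' 1
    · exact ha
  refine ⟨!![-e.1, -f.1, -k.1; -e.2, -f.2, -k.2; 0, 0, 1],
    ![a' 0 + e.1 + f.1 + 3 * k.1, a' 1 + e.2 + f.2 + 3 * k.2, 0], ?_, ?_⟩
  · rw [show Matrix.det !![-e.1, -f.1, -k.1; -e.2, -f.2, -k.2; 0, 0, 1] = 1 by
      rw [Matrix.det_fin_three]; simp; linarith, abs_one]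
  · have hrange : Set.range w = {w (j + 2), w (j + 3), w j, w (j + 1)} := by
      have hj : ∀ i, i = j + 2 ∨ i = j + 3 ∨ i = j ∨ i = j + 1 := by
        clear * -; revert j; decide
      ext y
      constructor
      · rintro ⟨i, rfl⟩
        rcases hj i with h | h | h | h <;> simp [h]
      · rintro (h | h | h | h) <;> exact ⟨_, h.symm⟩
    rw [hPw, M9, affMap_image_convexHull, hrange, hwcoord _ _ h0, hwcoord _ _ h1,
      hwcoord _ _ h2, hwcoord _ _ h3, hacoord]
    simp only [Set.image_insert_eq, Set.image_singleton]
    rw [Set.insert_comm (![(a' 0 : ℝ), a' 1, 3]), Set.insert_comm (![(a' 0 : ℝ), a' 1, 3]),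
      Set.insert_comm (![(a' 0 : ℝ), a' 1, 3]), Set.pair_comm (![(a' 0 : ℝ), a' 1, 3])]
    congr 5
    rotate_right
    rw [Set.singleton_eq_singleton_iff]
    all_goals
      funext l
      fin_cases l <;> simp [affMap, Fin.sum_univ_three] <;> ring
end

section
/- Let P ⊆ ℝ³ be the pyramid with base conv{(1,0,0), (−1,0,0), (0,1,0), (0,−1,0)} and apex a = (a₁, a₂, a₃) ∈ ℤ³ with a₃ ≥ 4, i.e., P = conv{(1,0,0), (−1,0,0), (0,1,0), (0,−1,0), a}. Then P is not a maximal lattice-free set: either int(P) ∩ ℤ³ ≠ ∅, or P is properly contained in a convex set K ⊆ ℝ³ with int(K) ∩ ℤ³ = ∅. -/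
open Set

/-- Moving from an interior point in a direction along which `L` increases stays in the set, so an
upper bound of `L` on the set is strict on the interior. -/
lemma lt_of_mem_interior_of_forall_le {E : Type*} [TopologicalSpace E] [AddCommGroup E]
    [Module ℝ E] [IsTopologicalAddGroup E] [ContinuousSMul ℝ E] {K : Set E} {L : E →ₗ[ℝ] ℝ} {c : ℝ}
    (hK : ∀ x ∈ K, L x ≤ c) {d : E} (hd : 0 < L d) {w : E} (hw : w ∈ interior K) : L w < c := by
  have hcont : Continuous fun t : ℝ => w + t • d := by fun_prop
  have hmem : (fun t : ℝ => w + t • d) ⁻¹' interior K ∈ nhds (0 : ℝ) :=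
    hcont.continuousAt.preimage_mem_nhds (by simpa using isOpen_interior.mem_nhds hw)
  obtain ⟨ε, hε, hball⟩ := Metric.mem_nhds_iff.1 hmem
  have hin : ε / 2 ∈ Metric.ball (0 : ℝ) ε := by
    rw [Metric.mem_ball, Real.dist_eq, sub_zero, abs_of_pos (by linarith)]
    linarith
  have h := hK _ (interior_subset (hball hin))
  rw [map_add, map_smul, smul_eq_mul] at h
  nlinarith [mul_pos (half_pos hε) hd]

/-- The linear functional on `ℝ³` with coefficients `p, q, r`. -/
noncomputable def linForm (p q r : ℝ) : (Fin 3 → ℝ) →ₗ[ℝ] ℝ :=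
  p • LinearMap.proj 0 + q • LinearMap.proj 1 + r • LinearMap.proj 2

@[simp] lemma linForm_apply (p q r : ℝ) (x : Fin 3 → ℝ) :
    linForm p q r x = p * x 0 + q * x 1 + r * x 2 := by
  simp [linForm]

/-- The pyramid with base `conv{±e₁, ±e₂}` and apex `a`. -/
def diamondPyramid (a : Fin 3 → ℤ) : Set (Fin 3 → ℝ) :=
  convexHull ℝ ({![1,0,0], ![-1,0,0], ![0,1,0], ![0,-1,0],
    (fun i => (a i : ℝ))} : Set (Fin 3 → ℝ))

lemma diamondPyramid_subset {a : Fin 3 → ℤ} {K : Set (Fin 3 → ℝ)} (hK : Convex ℝ K)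
    (h₁ : ![1,0,0] ∈ K) (h₂ : ![-1,0,0] ∈ K) (h₃ : ![0,1,0] ∈ K) (h₄ : ![0,-1,0] ∈ K)
    (ha : (fun i => (a i : ℝ)) ∈ K) : diamondPyramid a ⊆ K := by
  refine convexHull_min ?_ hK
  rintro x (rfl | rfl | rfl | rfl | rfl) <;> assumption

/-- The horizontal slices of the pyramid contain scaled diamonds. -/
lemma mem_diamondPyramid {a : Fin 3 → ℤ} (ha : 0 < a 2) {x : Fin 3 → ℝ} (hx : 0 ≤ x 2)
    (h : |a 2 * x 0 - a 0 * x 2| + |a 2 * x 1 - a 1 * x 2| ≤ a 2 - x 2) :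
    x ∈ diamondPyramid a := by
  have hpos : (0 : ℝ) < a 2 := by exact_mod_cast ha
  set u := a 2 * x 0 - a 0 * x 2 with hu
  set v := a 2 * x 1 - a 1 * x 2 with hv
  set δ := (a 2 - x 2 - |u| - |v|) / 4 with hδ
  have hδ0 : 0 ≤ δ := by rw [hδ]; linarith
  have hu1 := le_abs_self u
  have hu2 := neg_abs_le u
  have hv1 := le_abs_self v
  have hv2 := neg_abs_le v
  let p : Fin 5 → Fin 3 → ℝ :=
    ![![1,0,0], ![-1,0,0], ![0,1,0], ![0,-1,0], fun i => (a i : ℝ)]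
  let w : Fin 5 → ℝ := ![((|u| + u) / 2 + δ) / a 2, ((|u| - u) / 2 + δ) / a 2,
    ((|v| + v) / 2 + δ) / a 2, ((|v| - v) / 2 + δ) / a 2, x 2 / a 2]
  have hw0 : ∀ i ∈ Finset.univ, 0 ≤ w i := by
    intro i _
    fin_cases i <;> simp only [w] <;> refine div_nonneg ?_ hpos.le <;> linarith
  have hw1 : ∑ i, w i = 1 := by
    simp [w, Fin.sum_univ_five]
    field_simp
    rw [hδ]
    ring
  have hp : ∀ i ∈ Finset.univ, p i ∈ diamondPyramid a := by
    intro i _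
    apply subset_convexHull
    fin_cases i <;> simp [p]
  have hsum : ∑ i, w i • p i ∈ diamondPyramid a := (convex_convexHull ℝ _).sum_mem hw0 hw1 hp
  convert hsum using 1
  ext i
  rw [Finset.sum_apply, Fin.sum_univ_five]
  fin_cases i <;> simp [w, p] <;> field_simp <;> linarith

/-- A lattice point strictly inside a horizontal slice is interior to the pyramid. -/
lemma diamondPyramid_interior_inter_intPts_nonempty {a : Fin 3 → ℤ} (ha : 0 < a 2) {x y t : ℤ}
    (ht : 0 < t) (h : |a 2 * x - a 0 * t| + |a 2 * y - a 1 * t| < a 2 - t) :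
    (interior (diamondPyramid a) ∩ intPts 3).Nonempty := by
  refine ⟨![x, y, t], ?_, ?_⟩
  · let U : Set (Fin 3 → ℝ) := {w | 0 < w 2} ∩
      {w | |a 2 * w 0 - a 0 * w 2| + |a 2 * w 1 - a 1 * w 2| < a 2 - w 2}
    have hU : IsOpen U := by
      refine (isOpen_lt ?_ ?_).inter (isOpen_lt ?_ ?_) <;> fun_prop
    have hUP : U ⊆ diamondPyramid a := fun w hw => mem_diamondPyramid ha hw.1.le hw.2.le
    refine interior_maximal hUP hU ⟨?_, ?_⟩
    · simpa using ht
    · simp only [mem_ofPred_eq, Matrix.cons_val]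
      exact_mod_cast h
  · intro i
    fin_cases i
    exacts [⟨x, rfl⟩, ⟨y, rfl⟩, ⟨t, rfl⟩]

/-- If integral linear coordinates `X, Y` map the base into `conv{±e₁, ±e₂}` and the apex to
`(2, 1, 4)`, then the pyramid is strictly contained in the lattice-free simplex
`{z ≥ 0, X - Y ≤ 1, z ≤ 1 + X + Y, Y ≤ 1}`. -/
lemma diamondPyramid_ssubset_latticeFree {a : Fin 3 → ℤ} (ha : a 2 = 4) (e f : Fin 3 → ℤ)
    (w : Fin 2 → ℤ) (h₀ : |e 0| + |f 0| ≤ 1) (h₁ : |e 1| + |f 1| ≤ 1)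
    (hew : e 0 * w 0 + e 1 * w 1 = 2) (hfw : f 0 * w 0 + f 1 * w 1 = 1)
    (hea : e 0 * a 0 + e 1 * a 1 + e 2 * a 2 = 2) (hfa : f 0 * a 0 + f 1 * a 1 + f 2 * a 2 = 1) :
    ∃ K : Set (Fin 3 → ℝ), Convex ℝ K ∧ interior K ∩ intPts 3 = ∅ ∧
      diamondPyramid a ⊆ K ∧ diamondPyramid a ≠ K := by
  set X := linForm (e 0) (e 1) (e 2) with hX
  set Y := linForm (f 0) (f 1) (f 2) with hY
  set Z := linForm 0 0 1 with hZ
  have hea' : X (fun i => (a i : ℝ)) = 2 := by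
    simp only [hX, linForm_apply]; exact_mod_cast hea
  have hfa' : Y (fun i => (a i : ℝ)) = 1 := by
    simp only [hY, linForm_apply]; exact_mod_cast hfa
  have hZa : Z (fun i => (a i : ℝ)) = 4 := by
    simp only [hZ, linForm_apply, ha]; norm_num
  let d : Fin 3 → ℝ := ![w 0, w 1, 0]
  have hXd : X d = 2 := by
    simp [hX, d]; exact_mod_cast hew
  have hYd : Y d = 1 := by
    simp [hY, d]; exact_mod_cast hfw
  have hZd : Z d = 0 := by simp [hZ, d]
  have bound : ∀ m n : ℤ, |m| + |n| ≤ 1 → (m : ℝ) + n ≤ 1 ∧ (m : ℝ) - n ≤ 1 ∧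
      -(m : ℝ) + n ≤ 1 ∧ -(m : ℝ) - n ≤ 1 ∧ (n : ℝ) ≤ 1 ∧ -(n : ℝ) ≤ 1 := by
    intro m n h
    have : m + n ≤ 1 ∧ m - n ≤ 1 ∧ -m + n ≤ 1 ∧ -m - n ≤ 1 ∧ n ≤ 1 ∧ -n ≤ 1 := by
      have := abs_nonneg m
      have := le_abs_self m
      have := neg_le_abs m
      have := le_abs_self n
      have := neg_le_abs n
      omega
    exact_mod_cast this
  have b0 := bound _ _ h₀
  have b1 := bound _ _ h₁
  let K : Set (Fin 3 → ℝ) :=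
    {x | (-Z) x ≤ 0} ∩ {x | (X - Y) x ≤ 1} ∩ {x | (Z - X - Y) x ≤ 1} ∩ {x | Y x ≤ 1}
  have hKc : Convex ℝ K := by
    refine ((Convex.inter ?_ ?_).inter ?_).inter ?_ <;>
      exact convex_halfSpace_le (LinearMap.isLinear _) _
  refine ⟨K, hKc, ?_, ?_, ?_⟩
  · rw [eq_empty_iff_forall_notMem]
    rintro x ⟨hxK, hxI⟩
    obtain ⟨i, hi⟩ := hxI 0
    obtain ⟨j, hj⟩ := hxI 1
    obtain ⟨k, hk⟩ := hxI 2
    have s1 : (-Z) x < 0 := lt_of_mem_interior_of_forall_le (fun y hy => hy.1.1.1)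
      (d := ![0, 0, -1]) (by simp [hZ]) hxK
    have s2 : (X - Y) x < 1 := lt_of_mem_interior_of_forall_le (fun y hy => hy.1.1.2)
      (d := d) (by simp only [LinearMap.sub_apply, hXd, hYd]; norm_num) hxK
    have s3 : (Z - X - Y) x < 1 := lt_of_mem_interior_of_forall_le (fun y hy => hy.1.2)
      (d := -d) (by simp only [LinearMap.sub_apply, map_neg, hXd, hYd, hZd]; norm_num) hxK
    have s4 : Y x < 1 := lt_of_mem_interior_of_forall_le (fun y hy => hy.2)
      (d := d) (by rw [hYd]; norm_num) hxK
    have hXx : X x = ((e 0 * i + e 1 * j + e 2 * k : ℤ) : ℝ) := by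
      simp only [hX, linForm_apply, hi, hj, hk]; push_cast; ring
    have hYx : Y x = ((f 0 * i + f 1 * j + f 2 * k : ℤ) : ℝ) := by
      simp only [hY, linForm_apply, hi, hj, hk]; push_cast; ring
    have hZx : Z x = (k : ℝ) := by simp [hZ, hk]
    simp only [LinearMap.sub_apply, LinearMap.neg_apply, hXx, hYx, hZx] at s1 s2 s3 s4
    generalize e 0 * i + e 1 * j + e 2 * k = m at *
    generalize f 0 * i + f 1 * j + f 2 * k = n at *
    norm_cast at s1 s2 s3 s4
    omega
  · refine diamondPyramid_subset hKc ?_ ?_ ?_ ?_ ?_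
    case refine_5 =>
      refine ⟨⟨⟨?_, ?_⟩, ?_⟩, ?_⟩ <;>
        simp only [mem_ofPred_eq, LinearMap.sub_apply, LinearMap.neg_apply, hea', hfa', hZa] <;>
        norm_num
    all_goals
      refine ⟨⟨⟨?_, ?_⟩, ?_⟩, ?_⟩ <;>
        simp only [mem_ofPred_eq, LinearMap.sub_apply, LinearMap.neg_apply, hX, hY, hZ,
          linForm_apply, Matrix.cons_val] <;>
        linarith
  · intro hEq
    have hdK : d ∈ K := by
      refine ⟨⟨⟨?_, ?_⟩, ?_⟩, ?_⟩ <;>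
        simp only [mem_ofPred_eq, LinearMap.sub_apply, LinearMap.neg_apply, hXd, hYd, hZd] <;>
        norm_num
    have hsub : diamondPyramid a ⊆ {x | (X + Y - (1 / 2 : ℝ) • Z) x ≤ 1} := by
      refine diamondPyramid_subset (convex_halfSpace_le (LinearMap.isLinear _) _) ?_ ?_ ?_ ?_ ?_
      case refine_5 =>
        simp only [mem_ofPred_eq, LinearMap.sub_apply, LinearMap.add_apply, LinearMap.smul_apply,
          hea', hfa', hZa, smul_eq_mul]
        norm_num
      all_goals
        simp only [mem_ofPred_eq, LinearMap.sub_apply, LinearMap.add_apply, LinearMap.smul_apply,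
          hX, hY, hZ, linForm_apply, Matrix.cons_val, smul_eq_mul]
        linarith
    have := hsub (hEq ▸ hdK)
    simp only [mem_ofPred_eq, LinearMap.sub_apply, LinearMap.add_apply, LinearMap.smul_apply,
      hXd, hYd, hZd, smul_eq_mul] at this
    norm_num at this

/-- Division with remainder of least absolute value, together with an optimal approximation of
`2 * n` by multiples of `h`. -/
lemma exists_centered_residue {h : ℤ} (hh : 0 < h) (n : ℤ) :
    ∃ q q' r : ℤ, n = h * q + r ∧ 2 * |r| ≤ h ∧ |h * q' - 2 * n| = h - 2 * |r| := by
  have hdm := Int.mul_ediv_add_emod n h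
  have h0 := Int.emod_nonneg n hh.ne'
  have h1 := Int.emod_lt_of_pos n hh
  by_cases hc : 2 * (n % h) ≤ h
  · refine ⟨n / h, 2 * (n / h) + 1, n % h, by linarith, by rwa [abs_of_nonneg h0], ?_⟩
    rw [abs_of_nonneg h0, abs_of_nonneg] <;> linarith
  · refine ⟨n / h + 1, 2 * (n / h) + 1, n % h - h, by linarith, ?_, ?_⟩
    · rw [abs_of_nonpos] <;> linarith
    · rw [abs_of_nonpos (by linarith : n % h - h ≤ 0), abs_of_nonpos] <;> linarith

/-- A pyramid over the base `conv{±e₁, ±e₂}` with integer apex of height at least `4`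
is not maximal lattice-free. -/
theorem diamond_base_pyramid_not_maximal (a : Fin 3 → ℤ) (ha : 4 ≤ a 2)
    (P : Set (Fin 3 → ℝ))
    (hP : P = convexHull ℝ ({![1,0,0], ![-1,0,0], ![0,1,0], ![0,-1,0],
          (fun i => (a i : ℝ))} : Set (Fin 3 → ℝ))) :
    (interior P ∩ intPts 3).Nonempty ∨
    ∃ K : Set (Fin 3 → ℝ), Convex ℝ K ∧ interior K ∩ intPts 3 = ∅ ∧ P ⊆ K ∧ P ≠ K := by
  change P = diamondPyramid a at hP
  subst hP
  by_cases hne : (interior (diamondPyramid a) ∩ intPts 3).Nonempty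
  · exact Or.inl hne
  right
  have hpos : 0 < a 2 := by omega
  obtain ⟨p, p', r, hr, hr2, hp'⟩ := exists_centered_residue hpos (a 0)
  obtain ⟨q, q', s, hs, hs2, hq'⟩ := exists_centered_residue hpos (a 1)
  have slice₁ : a 2 - 1 ≤ |r| + |s| := by
    by_contra! hlt
    refine hne (diamondPyramid_interior_inter_intPts_nonempty hpos (x := p) (y := q) (t := 1)
      one_pos ?_)
    rwa [show a 2 * p - a 0 * 1 = -r by linarith, show a 2 * q - a 1 * 1 = -s by linarith,
      abs_neg, abs_neg]
  have slice₂ : a 2 - 2 ≤ (a 2 - 2 * |r|) + (a 2 - 2 * |s|) := by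
    by_contra! hlt
    refine hne (diamondPyramid_interior_inter_intPts_nonempty hpos (x := p') (y := q') (t := 2)
      two_pos ?_)
    rwa [mul_comm (a 0), mul_comm (a 1), hp', hq']
  have h4 : a 2 = 4 := by omega
  rw [h4] at hr hs
  have hcases : (|r| = 2 ∧ |s| = 1) ∨ (|r| = 1 ∧ |s| = 2) := by omega
  rcases hcases with ⟨hr', hs'⟩ | ⟨hr', hs'⟩
  · obtain ⟨k, hk⟩ : ∃ k, a 0 = 4 * k + 2 := by
      rcases (abs_eq two_pos.le).1 hr' with h | h
      exacts [⟨p, by omega⟩, ⟨p - 1, by omega⟩]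
    have hss : s * s = 1 := by rw [← abs_mul_abs_self, hs']; rfl
    refine diamondPyramid_ssubset_latticeFree h4 ![1, 0, -k] ![0, s, -(s * q)] ![2, s]
      ?_ ?_ ?_ ?_ ?_ ?_ <;> simp [hs', hss, hk, hs, h4] <;> linarith
  · obtain ⟨k, hk⟩ : ∃ k, a 1 = 4 * k + 2 := by
      rcases (abs_eq two_pos.le).1 hs' with h | h
      exacts [⟨q, by omega⟩, ⟨q - 1, by omega⟩]
    have hrr : r * r = 1 := by rw [← abs_mul_abs_self, hr']; rfl
    refine diamondPyramid_ssubset_latticeFree h4 ![0, 1, -k] ![r, 0, -(r * p)] ![r, 2]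
      ?_ ?_ ?_ ?_ ?_ ?_ <;> simp [hr', hrr, hk, hr, h4] <;> linarith
end
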